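/- Let G=(V,E,w) be an edge-weighted graph with E≠∅ and let k be a positive integer. Suppose there exists a subset T ⊆ V such that the induced subgraph G[T] is k-vertex-connected. Then there exists a subset S ⊆ V such that G[S] is k-vertex-connected and, for every nonempty subset T' ⊆ V, d(S) ≥ (6/19)·(w_min/w_max)·d(T'). In particular, d(S) is at least (6/19)·(w_min/w_max) times the maximum density of a subset inducing a k-vertex-connected subgraph. -/

import Mathlib

open Finset
open scoped Classical

noncomputable section

variable {V : Type*} [Fintype V] [DecidableEq V]

/-- The set of edges of `G` with both endpoints in `S`, i.e. the edge set `E(S)`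
of the induced subgraph `G[S]`. -/
def edgesIn (G : SimpleGraph V) (S : Finset V) : Finset (Sym2 V) :=
  Finset.univ.filter (fun e => e ∈ G.edgeSet ∧ ∀ v ∈ e, v ∈ S)

/-- `w(S)`: the total weight of the edges of the induced subgraph `G[S]`. -/
def wsum (G : SimpleGraph V) (w : Sym2 V → ℝ) (S : Finset V) : ℝ :=
  ∑ e ∈ edgesIn G S, w e

/-- The density `d(S) = w(S)/|S|` of the induced subgraph `G[S]`. -/
def density (G : SimpleGraph V) (w : Sym2 V → ℝ) (S : Finset V) : ℝ :=
  wsum G w S / S.card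

/-- The weighted degree of a vertex `v` in the induced subgraph `G[S]`. -/
def wdeg (G : SimpleGraph V) (w : Sym2 V → ℝ) (S : Finset V) (v : V) : ℝ :=
  ∑ e ∈ (edgesIn G S).filter (fun e => v ∈ e), w e

/-- `G[S]` is `k`-vertex-connected: it has at least `k+1` vertices, and deleting any set
of fewer than `k` vertices leaves a connected graph. -/
def VertexConnected (G : SimpleGraph V) (S : Finset V) (k : ℕ) : Prop :=
  k + 1 ≤ S.card ∧ ∀ D : Finset V, D ⊆ S → D.card < k →
    (G.induce ((S \ D : Finset V) : Set V)).Connected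

/-- The edge-weighted graph `G[S]` is `k`-edge-connected: it is connected, and every set `F`
of its edges whose removal disconnects it has total weight at least `k`. -/
def EdgeConnected (G : SimpleGraph V) (w : Sym2 V → ℝ) (S : Finset V) (k : ℝ) : Prop :=
  (G.induce (S : Set V)).Connected ∧
  ∀ F : Finset (Sym2 V), F ⊆ edgesIn G S →
    ¬ ((G.deleteEdges (F : Set (Sym2 V))).induce (S : Set V)).Connected →
    k ≤ ∑ e ∈ F, w e

/-- number of ordered adjacent pairs from `X` to `Y`. -/
def cnt (G : SimpleGraph V) (X Y : Finset V) : ℝ :=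
  ∑ u ∈ X, ∑ v ∈ Y, if G.Adj u v then (1 : ℝ) else 0

lemma cnt_union_left (G : SimpleGraph V) {X Y : Finset V} (Z : Finset V) (h : Disjoint X Y) :
    cnt G (X ∪ Y) Z = cnt G X Z + cnt G Y Z := by
  unfold cnt; exact Finset.sum_union h

lemma cnt_comm (G : SimpleGraph V) (X Y : Finset V) : cnt G X Y = cnt G Y X := by
  unfold cnt; rw [Finset.sum_comm]; simp only [G.adj_comm]

lemma cnt_union_right (G : SimpleGraph V) {X Y : Finset V} (Z : Finset V) (h : Disjoint X Y) :
    cnt G Z (X ∪ Y) = cnt G Z X + cnt G Z Y := by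
  rw [cnt_comm, cnt_union_left G Z h, cnt_comm G X, cnt_comm G Y]

lemma cnt_nonneg (G : SimpleGraph V) (X Y : Finset V) : 0 ≤ cnt G X Y := by
  unfold cnt
  refine Finset.sum_nonneg fun u _ => Finset.sum_nonneg fun v _ => ?_
  split_ifs <;> norm_num

lemma cnt_le (G : SimpleGraph V) (X Y : Finset V) : cnt G X Y ≤ (X.card : ℝ) * Y.card := by
  unfold cnt
  have : ∀ u ∈ X, (∑ v ∈ Y, if G.Adj u v then (1 : ℝ) else 0) ≤ Y.card := by
    intro u _
    calc (∑ v ∈ Y, if G.Adj u v then (1 : ℝ) else 0) ≤ ∑ v ∈ Y, (1 : ℝ) := by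
          refine Finset.sum_le_sum fun v _ => ?_
          split_ifs <;> norm_num
      _ = Y.card := by simp
  calc _ ≤ ∑ u ∈ X, (Y.card : ℝ) := Finset.sum_le_sum this
    _ = _ := by simp

lemma cnt_eq_zero (G : SimpleGraph V) (X Y : Finset V) (h : ∀ x ∈ X, ∀ y ∈ Y, ¬ G.Adj x y) :
    cnt G X Y = 0 := by
  unfold cnt
  refine Finset.sum_eq_zero fun u hu => Finset.sum_eq_zero fun v hv => ?_
  simp [h u hu v hv]

lemma cnt_singleton_self (G : SimpleGraph V) (v : V) : cnt G {v} {v} = 0 := by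
  simp [cnt]

lemma cnt_eq_sum (G : SimpleGraph V) (X Y : Finset V) :
    cnt G X Y = ∑ v ∈ X, cnt G {v} Y := by
  simp [cnt]

lemma cnt_mono (G : SimpleGraph V) (X : Finset V) {Y Z : Finset V} (h : Y ⊆ Z) :
    cnt G X Y ≤ cnt G X Z := by
  rw [← Finset.union_sdiff_of_subset h, cnt_union_right G X Finset.disjoint_sdiff]
  have := cnt_nonneg G X (Z \ Y)
  linarith

lemma cnt_self_le (G : SimpleGraph V) (X : Finset V) :
    cnt G X X ≤ (X.card : ℝ) * (X.card - 1) := by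
  rw [cnt_eq_sum]
  have : ∀ u ∈ X, cnt G {u} X ≤ (X.card : ℝ) - 1 := by
    intro u hu
    have h1 : X = {u} ∪ X.erase u := by
      rw [← Finset.insert_eq, Finset.insert_erase hu]
    have h2 : cnt G {u} X = cnt G {u} {u} + cnt G {u} (X.erase u) := by
      conv_lhs => rw [h1]
      exact cnt_union_right G _ (by simp)
    have h3 := cnt_le G {u} (X.erase u)
    rw [Finset.card_erase_of_mem hu, Nat.cast_sub (Finset.card_pos.2 ⟨u, hu⟩)] at h3
    rw [h2, cnt_singleton_self]
    simpa using h3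
  calc _ ≤ ∑ u ∈ X, ((X.card : ℝ) - 1) := Finset.sum_le_sum this
    _ = _ := by simp [mul_sub]

lemma cnt_singleton (G : SimpleGraph V) (v : V) (Y : Finset V) :
    cnt G {v} Y = ((Y.filter (fun u => G.Adj v u)).card : ℝ) := by
  simp [cnt]

/-- handshake -/
lemma cnt_self_eq (G : SimpleGraph V) (W : Finset V) :
    cnt G W W = 2 * ((edgesIn G W).card : ℝ) := by
  let H : SimpleGraph V :=
    { Adj := fun u v => G.Adj u v ∧ u ∈ W ∧ v ∈ W
      symm := ⟨fun u v h => ⟨h.1.symm, h.2.2, h.2.1⟩⟩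
      loopless := ⟨fun u h => G.loopless.irrefl u h.1⟩ }
  have h := H.sum_degrees_eq_twice_card_edges
  have he : H.edgeFinset = edgesIn G W := by
    ext e
    induction e using Sym2.ind with
    | _ x y => simp [edgesIn, H]
  have hd : ∀ v, (H.degree v : ℝ) = if v ∈ W then cnt G {v} W else 0 := by
    intro v
    rw [← SimpleGraph.card_neighborFinset_eq_degree]
    split_ifs with hv
    · rw [cnt_singleton]
      congr 2
      ext u
      simp [H, hv, and_comm]
    · norm_cast
      rw [Finset.card_eq_zero]
      ext u
      simp [H, hv]
  rw [he] at h
  have h' : ((∑ v, H.degree v : ℕ) : ℝ) = 2 * ((edgesIn G W).card : ℝ) := by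
    rw [h]; push_cast; ring
  rw [← h', cnt_eq_sum]
  push_cast
  rw [Finset.sum_congr rfl (fun v _ => hd v), Finset.sum_ite_mem]
  simp

lemma cnt_split (G : SimpleGraph V) {A S B : Finset V} (hAS : Disjoint A S) (hAB : Disjoint A B)
    (hSB : Disjoint S B) (h : ∀ x ∈ A, ∀ y ∈ B, ¬ G.Adj x y) :
    cnt G (A ∪ S ∪ B) (A ∪ S ∪ B) =
      cnt G A A + 2 * cnt G A S + cnt G (S ∪ B) (S ∪ B) := by
  have h0 := cnt_eq_zero G A B h
  have hd : Disjoint A (S ∪ B) := Finset.disjoint_union_right.2 ⟨hAS, hAB⟩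
  rw [Finset.union_assoc, cnt_union_left G _ hd, cnt_union_right G _ hd, cnt_union_right G _ hd,
    cnt_comm G (S ∪ B) A, cnt_union_right G A hSB, h0]
  ring

lemma exists_sep_aux (G : SimpleGraph V) (K : ℕ) (W : Finset V) (hW : K + 2 ≤ W.card)
    (hno : ¬ VertexConnected G W (K + 1)) :
    ∃ A S B : Finset V, Disjoint A S ∧ Disjoint A B ∧ Disjoint S B ∧ A ∪ S ∪ B = W ∧
      S.card ≤ K ∧ A.Nonempty ∧ B.Nonempty ∧ (∀ x ∈ A, ∀ y ∈ B, ¬ G.Adj x y) := by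
  unfold VertexConnected at hno
  push Not at hno
  obtain ⟨D, hD, hDc, hcon⟩ := hno (by omega)
  have hne : (W \ D).Nonempty := by
    rw [← Finset.card_pos, Finset.card_sdiff_of_subset hD]; omega
  obtain ⟨z, hz⟩ := hne
  have hpre : ¬ (G.induce ((W \ D : Finset V) : Set V)).Preconnected := by
    intro hp
    have : Nonempty ((W \ D : Finset V) : Set V) := ⟨⟨z, by exact_mod_cast hz⟩⟩
    exact hcon ⟨hp⟩
  unfold SimpleGraph.Preconnected at hpre
  push Not at hpre
  obtain ⟨u, v, huv⟩ := hpre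
  let A : Finset V := (W \ D).filter
    (fun x => ∃ hx : x ∈ ((W \ D : Finset V) : Set V),
      (G.induce ((W \ D : Finset V) : Set V)).Reachable u ⟨x, hx⟩)
  have hA : A ⊆ W \ D := Finset.filter_subset _ _
  have hAW : ∀ x ∈ A, x ∈ W ∧ x ∉ D := fun x hx => Finset.mem_sdiff.1 (hA hx)
  refine ⟨A, D, (W \ D) \ A, ?_, ?_, ?_, ?_, by omega, ?_, ?_, ?_⟩
  · rw [Finset.disjoint_left]; intro x hx; exact (hAW x hx).2
  · exact Finset.disjoint_sdiff
  · rw [Finset.disjoint_left]; intro x hx hx'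
    simp at hx'; exact hx'.1.2 hx
  · ext x
    simp only [Finset.mem_union, Finset.mem_sdiff]
    constructor
    · rintro ((h | h) | h)
      · exact (hAW x h).1
      · exact hD h
      · exact h.1.1
    · intro h
      by_cases h1 : x ∈ A <;> by_cases h2 : x ∈ D <;> simp [h1, h2, h]
  · exact ⟨u.1, Finset.mem_filter.2 ⟨by exact_mod_cast u.2, u.2, SimpleGraph.Reachable.refl _⟩⟩
  · refine ⟨v.1, Finset.mem_sdiff.2 ⟨by exact_mod_cast v.2, ?_⟩⟩
    intro hv
    obtain ⟨_, _, h⟩ := Finset.mem_filter.1 hv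
    exact huv h
  · intro x hx y hy hxy
    obtain ⟨hx0, hx1, hr⟩ := Finset.mem_filter.1 hx
    obtain ⟨hy0, hy1⟩ := Finset.mem_sdiff.1 hy
    apply hy1
    refine Finset.mem_filter.2 ⟨hy0, by exact_mod_cast hy0, hr.trans ?_⟩
    apply SimpleGraph.Adj.reachable
    simpa using hxy

lemma exists_sep_eq (G : SimpleGraph V) (K : ℕ) (W : Finset V) (hW : K + 2 ≤ W.card)
    (hno : ¬ VertexConnected G W (K + 1)) :
    ∃ A S B : Finset V, Disjoint A S ∧ Disjoint A B ∧ Disjoint S B ∧ A ∪ S ∪ B = W ∧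
      S.card = K ∧ A.Nonempty ∧ B.Nonempty ∧ (∀ x ∈ A, ∀ y ∈ B, ¬ G.Adj x y) := by
  obtain ⟨A, S, B, hAS, hAB, hSB, hu, hS, ⟨a, ha⟩, ⟨b, hb⟩, hadj⟩ := exists_sep_aux G K W hW hno
  have hSW : S ⊆ (W.erase a).erase b := by
    intro x hx
    have h1 : x ≠ a := fun h => Finset.disjoint_left.1 hAS ha (h ▸ hx)
    have h2 : x ≠ b := fun h => Finset.disjoint_left.1 hSB hx (h ▸ hb)
    have : x ∈ W := by rw [← hu]; simp [hx]
    simp [h1, h2, this]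
  have haW : a ∈ W := by rw [← hu]; simp [ha]
  have hbW : b ∈ W := by rw [← hu]; simp [hb]
  have hab : b ≠ a := fun h => Finset.disjoint_left.1 hAB ha (h ▸ hb)
  have hcard : K ≤ ((W.erase a).erase b).card := by
    rw [Finset.card_erase_of_mem (by simp [hab, hbW]), Finset.card_erase_of_mem haW]; omega
  obtain ⟨S', hSS', hS'W, hS'c⟩ := Finset.exists_subsuperset_card_eq hSW hS hcard
  refine ⟨A \ S', S', B \ S', ?_, ?_, ?_, ?_, hS'c, ⟨a, ?_⟩, ⟨b, ?_⟩, ?_⟩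
  · exact Finset.sdiff_disjoint
  · exact Finset.disjoint_of_subset_left Finset.sdiff_subset
      (Finset.disjoint_of_subset_right Finset.sdiff_subset hAB)
  · exact Finset.disjoint_sdiff
  · ext x
    have h1 : x ∈ S' → x ∈ W := fun h => by
      have := hS'W h; simp at this; exact this.2.2
    have h2 : x ∈ S → x ∈ S' := fun h => hSS' h
    have h3 : x ∈ W ↔ (x ∈ A ∨ x ∈ S) ∨ x ∈ B := by rw [← hu]; simp [or_assoc]
    simp only [Finset.mem_union, Finset.mem_sdiff]
    tauto
  · refine Finset.mem_sdiff.2 ⟨ha, fun h => ?_⟩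
    have := hS'W h; simp at this
  · refine Finset.mem_sdiff.2 ⟨hb, fun h => ?_⟩
    have := hS'W h; simp at this
  · intro x hx y hy
    exact hadj x (Finset.mem_sdiff.1 hx).1 y (Finset.mem_sdiff.1 hy).1

lemma exists_sep (G : SimpleGraph V) (K : ℕ) (W : Finset V) (hW : K + 2 ≤ W.card)
    (hno : ¬ VertexConnected G W (K + 1)) :
    ∃ A S B : Finset V, Disjoint A S ∧ Disjoint A B ∧ Disjoint S B ∧ A ∪ S ∪ B = W ∧
      S.card = K ∧ A.Nonempty ∧ B.Nonempty ∧ (∀ x ∈ A, ∀ y ∈ B, ¬ G.Adj x y) ∧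
      A.card ≤ B.card := by
  obtain ⟨A, S, B, hAS, hAB, hSB, hu, hS, hA, hB, hadj⟩ := exists_sep_eq G K W hW hno
  rcases le_total A.card B.card with h | h
  · exact ⟨A, S, B, hAS, hAB, hSB, hu, hS, hA, hB, hadj, h⟩
  · refine ⟨B, S, A, hSB.symm, hAB.symm, hAS.symm, ?_, hS, hB, hA,
      fun x hx y hy hxy => hadj y hy x hx hxy.symm, h⟩
    rw [← hu]; ext x; simp only [Finset.mem_union]; tauto

lemma card_three {A S B W : Finset V} (hAS : Disjoint A S) (hAB : Disjoint A B)
    (hSB : Disjoint S B) (hu : A ∪ S ∪ B = W) : W.card = A.card + S.card + B.card := by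
  rw [← hu, Finset.card_union_of_disjoint (Finset.disjoint_union_left.2 ⟨hAB, hSB⟩),
    Finset.card_union_of_disjoint hAS]

/-- quadratic bound -/
lemma small_bound (G : SimpleGraph V) (K : ℕ) (hno : ∀ W, ¬ VertexConnected G W (K + 1)) :
    ∀ n : ℕ, ∀ W : Finset V, W.card = n → K ≤ n →
      cnt G W W ≤ (K : ℝ) ^ 2 + 2 * K * (n - K) + ((n : ℝ) - K) ^ 2 / 3 := by
  intro n
  induction n using Nat.strong_induction_on with
  | _ n ih =>
    intro W hWn hKn
    by_cases h2 : K + 2 ≤ n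
    · obtain ⟨A, S, B, hAS, hAB, hSB, hu, hS, hA, hB, hadj, hle⟩ :=
        exists_sep G K W (by omega) (hno W)
      have hc := card_three hAS hAB hSB hu
      have hSBc : (S ∪ B).card = K + B.card := by
        rw [Finset.card_union_of_disjoint hSB, hS]
      have hApos := hA.card_pos
      have h1 := ih (K + B.card) (by omega) (S ∪ B) hSBc (by omega)
      have h3 := cnt_split G hAS hAB hSB hadj
      rw [hu] at h3
      have h4 := cnt_le G A A
      have h5 := cnt_le G A S
      rw [hS] at h5
      have h6 : (n : ℝ) = A.card + K + B.card := by
        rw [← hWn, hc, hS]; push_cast; ring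
      push_cast at h1
      have h7 : (A.card : ℝ) ≤ B.card := by exact_mod_cast hle
      have h8 : (0 : ℝ) ≤ A.card := by positivity
      rw [h3, h6]
      nlinarith [mul_nonneg h8 (sub_nonneg.2 h7)]
    · have h1 := cnt_self_le G W
      rw [hWn] at h1
      have : n = K ∨ n = K + 1 := by omega
      rcases this with h | h
      · subst h
        have : (0 : ℝ) ≤ n := by positivity
        nlinarith
      · subst h
        push_cast at *
        have : (0 : ℝ) ≤ K := by positivity
        nlinarith

lemma real_ineq_aux (K ε ρ α β P Q : ℝ) (hK : 0 ≤ K) (hε : 0 ≤ ε) (hε2 : 2 * ε ≤ K)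
    (hρ : 0 ≤ ρ) (hα : 0 ≤ α) (hαβ : α ≤ β) (hs : α + β = ε) (hPQ : P + Q = K + ε - ρ)
    (hP : 7 * K / 12 ≤ P + ρ) (hQ : 7 * K / 12 ≤ Q + ρ) :
    K * ε / 6 + 2 * ε ^ 2 / 3 ≤ ρ * ε + α * Q + β * P - α * β := by
  have h1 : α * (P + Q - 2 * (7 * K / 12 - ρ)) ≤
      α * (Q - (7 * K / 12 - ρ)) + β * (P - (7 * K / 12 - ρ)) := by
    nlinarith [mul_nonneg (sub_nonneg.2 hαβ) (sub_nonneg.2 hP)]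
  have h2 : 0 ≤ ε * (K - 2 * ε) := mul_nonneg hε (by linarith)
  have h3 : 0 ≤ K * (ε - 2 * α) := mul_nonneg hK (by linarith)
  have h4 : 0 ≤ α * ρ := mul_nonneg hα hρ
  have hQ' : Q = K + ε - ρ - P := by linarith
  have hβ : β = ε - α := by linarith
  subst hβ
  subst hQ'
  nlinarith [sq_nonneg α]

lemma real_ineq (K ε ρ α β P Q : ℝ) (hK : 0 ≤ K) (hε : 0 ≤ ε) (hε2 : 2 * ε ≤ K)
    (hρ : 0 ≤ ρ) (hα : 0 ≤ α) (hβ : 0 ≤ β) (hs : ε ≤ α + β) (hPQ : P + Q = K + ε - ρ)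
    (hαP : α ≤ P) (hβQ : β ≤ Q)
    (hP : 7 * K / 12 ≤ P + ρ) (hQ : 7 * K / 12 ≤ Q + ρ) :
    K * ε / 6 + 2 * ε ^ 2 / 3 ≤ ρ * ε + α * Q + β * P - α * β := by
  obtain ⟨α', β', h1, h2, h3, h4, h5⟩ : ∃ α' β' : ℝ, 0 ≤ α' ∧ 0 ≤ β' ∧ α' ≤ α ∧ β' ≤ β ∧
      α' + β' = ε := by
    rcases le_total α ε with h | h
    · exact ⟨α, ε - α, hα, by linarith, le_rfl, by linarith, by ring⟩
    · exact ⟨ε, 0, hε, le_rfl, h, hβ, by ring⟩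
  have key : K * ε / 6 + 2 * ε ^ 2 / 3 ≤ ρ * ε + α' * Q + β' * P - α' * β' := by
    rcases le_total α' β' with h | h
    · exact real_ineq_aux K ε ρ α' β' P Q hK hε hε2 hρ h1 h h5 hPQ hP hQ
    · have := real_ineq_aux K ε ρ β' α' Q P hK hε hε2 hρ h2 h (by linarith) (by linarith) hQ hP
      linarith
  have e1 : 0 ≤ (α - α') * (Q - β) := mul_nonneg (by linarith) (by linarith)
  have e2 : 0 ≤ (β - β') * (P - α') := mul_nonneg (by linarith) (by linarith)
  nlinarith

/-- if `A'` misses `A`, then few edges go between them -/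
lemma cnt_side (G : SimpleGraph V) {A A' S' B' : Finset V} (hAW : A ⊆ A' ∪ S' ∪ B')
    (hdis : Disjoint A' A) (hadj : ∀ x ∈ A', ∀ y ∈ B', ¬ G.Adj x y) :
    cnt G A A' ≤ (A'.card : ℝ) * S'.card := by
  have h1 : cnt G A' A ≤ cnt G A' (S' ∪ (B' \ S')) := by
    apply cnt_mono
    intro x hx
    have := hAW hx
    have h2 : x ∉ A' := fun h => Finset.disjoint_left.1 hdis h hx
    simp only [Finset.mem_union, Finset.mem_sdiff] at *
    tauto
  rw [cnt_union_right G _ Finset.disjoint_sdiff,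
    cnt_eq_zero G A' (B' \ S') (fun x hx y hy => hadj x hx y (Finset.mem_sdiff.1 hy).1)] at h1
  have := cnt_le G A' S'
  rw [cnt_comm]
  linarith

lemma minW (G : SimpleGraph V) (K : ℕ) (hno : ∀ W, ¬ VertexConnected G W (K + 1))
    (A S : Finset V) :
    ∃ W, A ⊆ W ∧ W ⊆ A ∪ S ∧ cnt G A (S \ W) ≤ K * ((S \ W).card : ℝ) ∧
      (K + 2 ≤ W.card → ∃ A' S' B' : Finset V, Disjoint A' S' ∧ Disjoint A' B' ∧ Disjoint S' B' ∧
        A' ∪ S' ∪ B' = W ∧ S'.card = K ∧ (A' ∩ A).Nonempty ∧ (B' ∩ A).Nonempty ∧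
        (∀ x ∈ A', ∀ y ∈ B', ¬ G.Adj x y)) := by
  let P : Finset (Finset V) := Finset.univ.filter
    (fun W => A ⊆ W ∧ W ⊆ A ∪ S ∧ cnt G A (S \ W) ≤ K * ((S \ W).card : ℝ))
  have hP : P.Nonempty := by
    refine ⟨A ∪ S, Finset.mem_filter.2 ⟨Finset.mem_univ _, Finset.subset_union_left, le_rfl, ?_⟩⟩
    have : S \ (A ∪ S) = ∅ := by
      rw [Finset.sdiff_eq_empty_iff_subset]; exact Finset.subset_union_right
    rw [this]; simp [cnt]
  obtain ⟨W, hW, hmin⟩ := Finset.exists_min_image P Finset.card hP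
  obtain ⟨-, hAW, hWS, hle⟩ := Finset.mem_filter.1 hW
  refine ⟨W, hAW, hWS, hle, fun hc => ?_⟩
  obtain ⟨A', S', B', h1, h2, h3, hu, hS', hA', hB', hadj, -⟩ := exists_sep G K W hc (hno W)
  have key : ∀ X Y : Finset V, X.Nonempty → X ⊆ W → W ⊆ X ∪ S' ∪ Y →
      (∀ x ∈ X, ∀ y ∈ Y, ¬ G.Adj x y) → (X ∩ A).Nonempty := by
    intro X Y hX hXW hWu hXY
    by_contra hcon
    rw [Finset.not_nonempty_iff_eq_empty, ← Finset.disjoint_iff_inter_eq_empty] at hcon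
    have hb := cnt_side G (hAW.trans hWu) hcon hXY
    have hXS : X ⊆ S := by
      intro x hx
      have h := hWS (hXW hx)
      have h' : x ∉ A := fun h => Finset.disjoint_left.1 hcon hx h
      simpa [h'] using h
    have hsd : S \ (W \ X) = (S \ W) ∪ X := by
      ext x
      have := @hXS x
      simp only [Finset.mem_union, Finset.mem_sdiff]
      tauto
    have hdj : Disjoint (S \ W) X := by
      rw [Finset.disjoint_left]; intro x hx hx'
      exact (Finset.mem_sdiff.1 hx).2 (hXW hx')
    have hmem : W \ X ∈ P := by
      refine Finset.mem_filter.2 ⟨Finset.mem_univ _, ?_, Finset.sdiff_subset.trans hWS, ?_⟩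
      · intro x hx
        exact Finset.mem_sdiff.2 ⟨hAW hx, fun h => Finset.disjoint_left.1 hcon h hx⟩
      · rw [hsd, cnt_union_right G A hdj, Finset.card_union_of_disjoint hdj]
        rw [hS'] at hb
        push_cast
        linarith
    have h4 := hmin _ hmem
    rw [Finset.card_sdiff_of_subset hXW] at h4
    have := hX.card_pos
    have := Finset.card_le_card hXW
    omega
  refine ⟨A', S', B', h1, h2, h3, hu, hS', ?_, ?_, hadj⟩
  · refine key A' B' hA' ?_ (by rw [hu]) hadj
    rw [← hu]; intro x hx; simp [hx]
  · refine key B' A' hB' ?_ ?_ (fun x hx y hy hxy => hadj y hy x hx hxy.symm)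
    · rw [← hu]; intro x hx; simp [hx]
    · rw [← hu]; intro x hx
      simp only [Finset.mem_union] at *
      tauto

lemma card_inter_three {X A S B W : Finset V} (hAS : Disjoint A S) (hAB : Disjoint A B)
    (hSB : Disjoint S B) (hu : A ∪ S ∪ B = W) :
    (X ∩ W).card = (X ∩ A).card + (X ∩ S).card + (X ∩ B).card := by
  apply card_three (hAS.mono Finset.inter_subset_right Finset.inter_subset_right)
    (hAB.mono Finset.inter_subset_right Finset.inter_subset_right)
    (hSB.mono Finset.inter_subset_right Finset.inter_subset_right)
  rw [← hu, Finset.inter_union_distrib_left, Finset.inter_union_distrib_left]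

lemma cnt_three_right (G : SimpleGraph V) {X Y A S B W : Finset V} (hAS : Disjoint A S)
    (hAB : Disjoint A B) (hSB : Disjoint S B) (hu : A ∪ S ∪ B = W) :
    cnt G X (Y ∩ W) = cnt G X (Y ∩ A) + cnt G X (Y ∩ S) + cnt G X (Y ∩ B) := by
  have e : Y ∩ W = Y ∩ A ∪ Y ∩ S ∪ Y ∩ B := by
    rw [← hu, Finset.inter_union_distrib_left, Finset.inter_union_distrib_left]
  have d1 : Disjoint (Y ∩ A) (Y ∩ S) :=
    hAS.mono Finset.inter_subset_right Finset.inter_subset_right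
  have d2 : Disjoint (Y ∩ A) (Y ∩ B) :=
    hAB.mono Finset.inter_subset_right Finset.inter_subset_right
  have d3 : Disjoint (Y ∩ S) (Y ∩ B) :=
    hSB.mono Finset.inter_subset_right Finset.inter_subset_right
  rw [e, cnt_union_right G X (Finset.disjoint_union_left.2 ⟨d2, d3⟩), cnt_union_right G X d1]

/-- rectangle count with two forbidden corners -/
lemma cnt_corner (G : SimpleGraph V) {X Y A S B W : Finset V} (hAS : Disjoint A S)
    (hAB : Disjoint A B) (hSB : Disjoint S B) (hu : A ∪ S ∪ B = W)
    (hadj : ∀ x ∈ A, ∀ y ∈ B, ¬ G.Adj x y) :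
    cnt G (X ∩ W) (Y ∩ W) ≤ ((X ∩ W).card : ℝ) * (Y ∩ W).card
      - (X ∩ A).card * (Y ∩ B).card - (X ∩ B).card * (Y ∩ A).card := by
  have zero1 : cnt G (X ∩ A) (Y ∩ B) = 0 := cnt_eq_zero G _ _ fun x hx y hy =>
    hadj x (Finset.mem_inter.1 hx).2 y (Finset.mem_inter.1 hy).2
  have zero2 : cnt G (X ∩ B) (Y ∩ A) = 0 := cnt_eq_zero G _ _ fun x hx y hy h =>
    hadj y (Finset.mem_inter.1 hy).2 x (Finset.mem_inter.1 hx).2 h.symm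
  rw [cnt_comm, cnt_three_right G hAS hAB hSB hu, cnt_comm G _ (X ∩ A), cnt_comm G _ (X ∩ S),
    cnt_comm G _ (X ∩ B), cnt_three_right G hAS hAB hSB hu, cnt_three_right G hAS hAB hSB hu,
    cnt_three_right G hAS hAB hSB hu, zero1, zero2,
    card_inter_three (X := X) hAS hAB hSB hu, card_inter_three (X := Y) hAS hAB hSB hu]
  push_cast
  nlinarith [cnt_le G (X ∩ A) (Y ∩ A), cnt_le G (X ∩ A) (Y ∩ S), cnt_le G (X ∩ S) (Y ∩ A),
    cnt_le G (X ∩ S) (Y ∩ S), cnt_le G (X ∩ S) (Y ∩ B), cnt_le G (X ∩ B) (Y ∩ S),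
    cnt_le G (X ∩ B) (Y ∩ B)]

lemma deg_side (G : SimpleGraph V) {A S A' S' B' W : Finset V} (hu : A' ∪ S' ∪ B' = W)
    (hAW : A ⊆ W) (hadj : ∀ x ∈ A', ∀ y ∈ B', ¬ G.Adj x y) (v : V) (hv : v ∈ A') :
    cnt G {v} (A ∪ S) ≤ (A'.card : ℝ) + S'.card + (S \ W).card := by
  rw [cnt_singleton]
  have : (A ∪ S).filter (fun u => G.Adj v u) ⊆ A' ∪ S' ∪ (S \ W) := by
    intro x hx
    obtain ⟨h1, h2⟩ := Finset.mem_filter.1 hx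
    have h3 : x ∉ B' := fun h => hadj v hv x h h2
    have h4 := @hAW x
    have h5 : x ∈ W ↔ (x ∈ A' ∨ x ∈ S') ∨ x ∈ B' := by rw [← hu]; simp [or_assoc]
    simp only [Finset.mem_union, Finset.mem_sdiff] at *
    tauto
  have h := Finset.card_le_card this
  have h' := Finset.card_union_le (A' ∪ S') (S \ W)
  have h'' := Finset.card_union_le A' S'
  exact_mod_cast (by omega : ((A ∪ S).filter (fun u => G.Adj v u)).card ≤
    A'.card + S'.card + (S \ W).card)

set_option maxHeartbeats 2000000 in
lemma Q_bound (G : SimpleGraph V) (K : ℕ) (hno : ∀ W, ¬ VertexConnected G W (K + 1))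
    (A S : Finset V) (hAS : Disjoint A S) (hS : S.card = K) (hcard : K + 1 ≤ A.card)
    (hcard2 : 2 * A.card ≤ 3 * K)
    (hdeg : ∀ v ∈ A, 19 * (K : ℝ) / 12 ≤ cnt G {v} (A ∪ S)) :
    cnt G A A + 2 * cnt G A S ≤ (A.card : ℝ) ^ 2 + 2 * A.card * K
      - K * (A.card - K) / 3 - 4 * ((A.card : ℝ) - K) ^ 2 / 3 := by
  obtain ⟨W, hAW, hWS, hR, hsep⟩ := minW G K hno A S
  have hS2 : cnt G A S = cnt G A (S ∩ W) + cnt G A (S \ W) := by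
    rw [← cnt_union_right G A (Finset.disjoint_sdiff_inter S W).symm]
    congr 1
    ext x
    simp only [Finset.mem_union, Finset.mem_inter, Finset.mem_sdiff]
    tauto
  have hSc : (S ∩ W).card + (S \ W).card = K := by
    rw [Finset.card_inter_add_card_sdiff, hS]
  have hAWi : A ∩ W = A := Finset.inter_eq_left.2 hAW
  have hSWc : ((S ∩ W).card : ℝ) = K - (S \ W).card := by
    rw [← hSc]; push_cast; ring
  have hWc : W.card = A.card + (S ∩ W).card := by
    rw [← Finset.card_union_of_disjoint (hAS.mono_right Finset.inter_subset_left)]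
    congr 1
    ext x
    have h1 := @hAW x
    have h2 := @hWS x
    simp only [Finset.mem_union, Finset.mem_inter] at *
    tauto
  have r1 : (K : ℝ) + 1 ≤ A.card := by exact_mod_cast hcard
  have r2 : 2 * (A.card : ℝ) ≤ 3 * K := by exact_mod_cast hcard2
  have r3 : (0 : ℝ) ≤ K := by positivity
  by_cases hc : K + 2 ≤ W.card
  · obtain ⟨A', S', B', h1, h2, h3, hu, hS', ⟨x, hx⟩, ⟨y, hy⟩, hadj⟩ := hsep hc
    have hx' := Finset.mem_inter.1 hx
    have hy' := Finset.mem_inter.1 hy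
    have dx := (hdeg x hx'.2).trans (deg_side G hu hAW hadj x hx'.1)
    have hu' : B' ∪ S' ∪ A' = W := by
      rw [← hu]; ext z; simp only [Finset.mem_union]; tauto
    have dy := (hdeg y hy'.2).trans (deg_side G hu' hAW
      (fun x hx y hy hxy => hadj y hy x hx hxy.symm) y hy'.1)
    have cAA := cnt_corner G (X := A) (Y := A) h1 h2 h3 hu hadj
    have cAS := cnt_corner G (X := A) (Y := S) h1 h2 h3 hu hadj
    rw [hAWi] at cAA cAS
    have part : ∀ Z ⊆ W, Z.card = (A ∩ Z).card + (S ∩ Z).card := by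
      intro Z hZ
      rw [← Finset.card_union_of_disjoint
        (hAS.mono Finset.inter_subset_left Finset.inter_subset_left)]
      congr 1
      ext x
      have h1 := @hZ x
      have h2 := @hWS x
      simp only [Finset.mem_union, Finset.mem_inter] at *
      tauto
    have pA := part A' (by rw [← hu]; intro z hz; simp [hz])
    have pS := part S' (by rw [← hu]; intro z hz; simp [hz])
    have pB := part B' (by rw [← hu]; intro z hz; simp [hz])
    have iA := card_inter_three (X := A) h1 h2 h3 hu
    have iS := card_inter_three (X := S) h1 h2 h3 hu
    rw [hAWi] at iA
    rw [hSWc] at cAS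
    rw [hS'] at dx dy pS
    have iSr : ((S ∩ W).card : ℝ) = (S ∩ A').card + (S ∩ S').card + (S ∩ B').card := by
      exact_mod_cast iS
    have iAr : (A.card : ℝ) = (A ∩ A').card + (A ∩ S').card + (A ∩ B').card := by
      exact_mod_cast iA
    have pAr : (A'.card : ℝ) = (A ∩ A').card + (S ∩ A').card := by exact_mod_cast pA
    have pBr : (B'.card : ℝ) = (A ∩ B').card + (S ∩ B').card := by exact_mod_cast pB
    have pSr : (K : ℝ) = (A ∩ S').card + (S ∩ S').card := by exact_mod_cast pS
    have n1 : (0 : ℝ) ≤ (S ∩ A').card := by positivity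
    have n2 : (0 : ℝ) ≤ (S ∩ B').card := by positivity
    have n3 : (0 : ℝ) ≤ (S ∩ S').card := by positivity
    have key := real_ineq K (A.card - K) (S \ W).card (A ∩ A').card (A ∩ B').card A'.card B'.card
      r3 (by linarith) (by linarith) (by positivity) (by positivity) (by positivity)
      (by linarith) (by linarith) (by linarith) (by linarith) (by linarith) (by linarith)
    rw [hS2]
    rw [pAr, pBr] at key
    linarith
  · have hz : (S ∩ W).card = 0 := by omega
    have hA1 : A.card = K + 1 := by omega
    have hρ : (S \ W).card = K := by omega
    have e0 : cnt G A (S ∩ W) = 0 := by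
      rw [Finset.card_eq_zero] at hz; rw [hz]; simp [cnt]
    have e1 := cnt_le G A A
    rw [hρ] at hR
    rw [hS2, e0]
    have hA1r : (A.card : ℝ) = K + 1 := by exact_mod_cast hA1
    rw [hA1r] at e1 r2 ⊢
    nlinarith

lemma main_bound (G : SimpleGraph V) (K : ℕ) (hK : 1 ≤ K)
    (hno : ∀ W, ¬ VertexConnected G W (K + 1)) :
    ∀ n : ℕ, ∀ W : Finset V, W.card = n → 5 * K ≤ 2 * n →
      cnt G W W ≤ 19 / 6 * (K : ℝ) * (n - K) := by
  intro n
  induction n using Nat.strong_induction_on with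
  | _ n ih =>
    intro W hWn hKn
    have k1 : (1 : ℝ) ≤ K := by exact_mod_cast hK
    have k2 : 5 * (K : ℝ) ≤ 2 * n := by exact_mod_cast hKn
    by_cases hsm : n ≤ 3 * K
    · have h := small_bound G K hno n W hWn (by omega)
      have k3 : (n : ℝ) ≤ 3 * K := by exact_mod_cast hsm
      nlinarith [mul_nonneg (sub_nonneg.2 k2) (sub_nonneg.2 k3)]
    by_cases hlow : ∃ v ∈ W, cnt G {v} W < 19 * (K : ℝ) / 12
    · obtain ⟨v, hv, hlt⟩ := hlow
      have hWe : W = {v} ∪ W.erase v := by rw [← Finset.insert_eq, Finset.insert_erase hv]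
      have hd : Disjoint {v} (W.erase v) := by simp
      have h1 := ih (n - 1) (by omega) (W.erase v)
        (by rw [Finset.card_erase_of_mem hv, hWn]) (by omega)
      have e1 : cnt G W W = cnt G {v} W + cnt G (W.erase v) W := by
        conv_lhs => rw [hWe]
        rw [cnt_union_left G _ hd, ← hWe]
      have e2 : cnt G (W.erase v) W = cnt G (W.erase v) {v} + cnt G (W.erase v) (W.erase v) := by
        conv_lhs => rw [hWe]
        rw [cnt_union_right G _ hd, ← hWe]
      have e3 := cnt_mono G {v} (Finset.erase_subset v W)
      rw [cnt_comm] at e3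
      rw [Nat.cast_sub (by omega)] at h1
      push_cast at h1
      nlinarith
    push Not at hlow
    obtain ⟨A, S, B, hAS, hAB, hSB, hu, hS, hA, hB, hadj, hle⟩ :=
      exists_sep G K W (by omega) (hno W)
    have hc := card_three hAS hAB hSB hu
    have hSBc : (S ∪ B).card = K + B.card := by
      rw [Finset.card_union_of_disjoint hSB, hS]
    have hSAc : (A ∪ S).card = K + A.card := by
      rw [Finset.card_union_of_disjoint hAS, hS]; ring
    have hApos := hA.card_pos
    have hBpos := hB.card_pos
    have h3 := cnt_split G hAS hAB hSB hadj
    rw [hu] at h3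
    have h6 : (n : ℝ) = A.card + K + B.card := by
      rw [← hWn, hc, hS]; push_cast; ring
    have hT1 : cnt G A A + 2 * cnt G A S ≤ (A.card : ℝ) ^ 2 + 2 * A.card * K := by
      have h4 := cnt_le G A A
      have h5 := cnt_le G A S
      rw [hS] at h5
      nlinarith
    have hdeg : ∀ v ∈ A, 19 * (K : ℝ) / 12 ≤ cnt G {v} (A ∪ S) := by
      intro v hv
      have hvW : v ∈ W := by rw [← hu]; simp [hv]
      have h := hlow v hvW
      rw [← hu, cnt_union_right G _ (Finset.disjoint_union_left.2 ⟨hAB, hSB⟩),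
        cnt_eq_zero G {v} B (by
          intro x hx y hy; rw [Finset.mem_singleton] at hx; subst hx; exact hadj _ hv y hy)] at h
      linarith
    have a0 : (0 : ℝ) ≤ A.card := by positivity
    have ab : (A.card : ℝ) ≤ B.card := by exact_mod_cast hle
    have k4 : 3 * (K : ℝ) ≤ n := by exact_mod_cast (by omega : 3 * K ≤ n)
    rw [h6] at k4
    by_cases hb : 3 * K ≤ 2 * B.card
    · have h1 := ih (K + B.card) (by omega) (S ∪ B) hSBc (by omega)
      push_cast at h1
      by_cases ha : 3 * K ≤ 2 * A.card
      · have h2 := ih (K + A.card) (by omega) (A ∪ S) hSAc (by omega)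
        push_cast at h2
        have h7 : cnt G (A ∪ S) (A ∪ S) = cnt G A A + 2 * cnt G A S + cnt G S S := by
          have := cnt_split G (B := ∅) hAS (by simp) (by simp) (by simp)
          simpa using this
        have h8 := cnt_nonneg G S S
        rw [h3, h6]
        nlinarith
      · have har : 2 * (A.card : ℝ) ≤ 3 * K := by exact_mod_cast (by omega : 2 * A.card ≤ 3 * K)
        have hT : cnt G A A + 2 * cnt G A S ≤ 19 / 6 * (K : ℝ) * A.card := by
          by_cases haK : A.card ≤ K
          · have : (A.card : ℝ) ≤ K := by exact_mod_cast haK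
            nlinarith
          · have h := Q_bound G K hno A S hAS hS (by omega) (by omega) hdeg
            have : (K : ℝ) ≤ A.card := by exact_mod_cast (by omega : K ≤ A.card)
            nlinarith [mul_nonneg (by linarith : (0 : ℝ) ≤ 2 * K - A.card)
              (by linarith : (0 : ℝ) ≤ 3 * K - 2 * A.card)]
        rw [h3, h6]
        nlinarith
    · have h1 := small_bound G K hno (K + B.card) (S ∪ B) hSBc (by omega)
      push_cast at h1
      have hbr : 2 * (B.card : ℝ) ≤ 3 * K := by exact_mod_cast (by omega : 2 * B.card ≤ 3 * K)
      rw [h3, h6]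
      by_cases haK : A.card ≤ K
      · have haKr : (A.card : ℝ) ≤ K := by exact_mod_cast haK
        generalize (A.card : ℝ) = a at *
        generalize (B.card : ℝ) = b at *
        have q1 : 0 ≤ (K - a) * (a + b - 2 * K) := mul_nonneg (by linarith) (by linarith)
        have q2 : 0 ≤ (3 * K - 2 * b) * (a + b - 2 * K) := mul_nonneg (by linarith) (by linarith)
        have q3 : 0 ≤ (3 * K - 2 * b) * (K - a) := mul_nonneg (by linarith) (by linarith)
        have q4 : 0 ≤ (K : ℝ) * (a + b - 2 * K) := mul_nonneg (by linarith) (by linarith)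
        have q5 : 0 ≤ (K : ℝ) * (K - a) := mul_nonneg (by linarith) (by linarith)
        have q6 : 0 ≤ (K : ℝ) * (3 * K - 2 * b) := mul_nonneg (by linarith) (by linarith)
        nlinarith
      · have h := Q_bound G K hno A S hAS hS (by omega) (by omega) hdeg
        have haKr : (K : ℝ) ≤ A.card := by exact_mod_cast (by omega : K ≤ A.card)
        nlinarith [mul_nonneg (sub_nonneg.2 ab)
          (by linarith : (0 : ℝ) ≤ 19 / 2 * K - 6 * K - A.card - B.card)]

lemma VertexConnected.mono {G : SimpleGraph V} {S : Finset V} {k l : ℕ} (h : k ≤ l)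
    (hS : VertexConnected G S l) : VertexConnected G S k :=
  ⟨by have := hS.1; omega, fun D hD hc => hS.2 D hD (by omega)⟩

lemma VertexConnected.edges {G : SimpleGraph V} {S : Finset V} {k : ℕ}
    (hS : VertexConnected G S k) : (k : ℝ) * S.card ≤ 2 * (edgesIn G S).card := by
  rw [← cnt_self_eq, cnt_eq_sum]
  have : ∀ v ∈ S, (k : ℝ) ≤ cnt G {v} S := by
    intro v hv
    rw [cnt_singleton]
    norm_cast
    by_contra hlt
    push Not at hlt
    set N := S.filter (fun u => G.Adj v u) with hN
    have hNS : N ⊆ S := Finset.filter_subset _ _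
    have hcon := hS.2 N hNS hlt
    have hvN : v ∈ S \ N := by simp [hN, hv]
    have hcard : 1 < (S \ N).card := by
      rw [Finset.card_sdiff_of_subset hNS]; have := hS.1; omega
    obtain ⟨u, hu, huv⟩ := Finset.exists_mem_ne hcard v
    have hr := hcon.preconnected ⟨v, by exact_mod_cast hvN⟩ ⟨u, by exact_mod_cast hu⟩
    obtain ⟨p⟩ := hr
    cases p with
    | nil => exact huv rfl
    | cons hadj q =>
      rename_i z
      have hz : z.1 ∈ S \ N := by exact_mod_cast z.2
      have hz' := Finset.mem_sdiff.1 hz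
      apply hz'.2
      refine Finset.mem_filter.2 ⟨hz'.1, ?_⟩
      simpa using hadj
  calc (k : ℝ) * S.card = ∑ v ∈ S, (k : ℝ) := by simp [mul_comm]
    _ ≤ _ := Finset.sum_le_sum this

/-- unweighted version -/
lemma exists_dense (G : SimpleGraph V) (k : ℕ) (hk : 0 < k) (T W : Finset V)
    (hT : VertexConnected G T k) (hW : W.Nonempty) :
    ∃ S, VertexConnected G S k ∧
      6 / 19 * (((edgesIn G W).card : ℝ) / W.card) * S.card ≤ (edgesIn G S).card := by
  set D : ℝ := ((edgesIn G W).card : ℝ) / W.card with hD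
  have hWpos : (0 : ℝ) < W.card := by exact_mod_cast hW.card_pos
  have hDW : D * W.card = (edgesIn G W).card := by rw [hD]; field_simp
  have hfin : ∀ (S : Finset V) (l : ℕ), 12 * D / 19 ≤ l → VertexConnected G S l →
      6 / 19 * D * S.card ≤ (edgesIn G S).card := by
    intro S l hl hS
    have h := hS.edges
    have : (0 : ℝ) ≤ S.card := by positivity
    nlinarith
  by_cases hkD : 12 * D / 19 ≤ k
  · exact ⟨T, hT, hfin T k hkD hT⟩
  push Not at hkD
  have hlt : k < ⌈12 * D / 19⌉₊ := Nat.lt_ceil.2 hkD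
  obtain ⟨K, hK⟩ : ∃ K, ⌈12 * D / 19⌉₊ = K + 1 := ⟨⌈12 * D / 19⌉₊ - 1, by omega⟩
  have hKD : (K : ℝ) < 12 * D / 19 := Nat.lt_ceil.1 (by omega)
  have hle := Nat.le_ceil (12 * D / 19)
  rw [hK] at hle
  by_cases hex : ∃ S, VertexConnected G S (K + 1)
  · obtain ⟨S, hS⟩ := hex
    exact ⟨S, hS.mono (by omega), hfin S _ hle hS⟩
  exfalso
  push Not at hex
  have c1 := cnt_self_le G W
  have c2 := cnt_self_eq G W
  rw [← hDW] at c2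
  have hK0 : (0 : ℝ) ≤ K := by positivity
  have hWD : 2 * D ≤ W.card - 1 := by
    have : W.card * (2 * D) ≤ (W.card : ℝ) * (W.card - 1) := by linarith
    exact le_of_mul_le_mul_left this hWpos
  have h5 : 5 * (K : ℝ) ≤ 2 * W.card := by linarith
  have hm := main_bound G K (by omega) hex W.card W rfl (by exact_mod_cast h5)
  rw [c2] at hm
  nlinarith

/-- A `(6/19)·(wmin/wmax)`-approximation for the densest `k`-vertex-connected subgraph
problem: if some `G[T]` is `k`-vertex-connected, then there is `S` with `G[S]`
`k`-vertex-connected whose density is at least `(6/19)·(wmin/wmax)` times the density of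
every nonempty subset of `V`. -/
theorem approx_densest_vertex_connected (G : SimpleGraph V) (w : Sym2 V → ℝ)
    (hE : (edgesIn G Finset.univ).Nonempty)
    (hw : ∀ e ∈ G.edgeSet, 0 < w e)
    (k : ℕ) (hk : 0 < k)
    (hfeas : ∃ T : Finset V, VertexConnected G T k) :
    ∃ S : Finset V, VertexConnected G S k ∧
      ∀ T' : Finset V, T'.Nonempty →
        ((6 : ℝ) / 19) *
            ((edgesIn G Finset.univ).inf' hE w / (edgesIn G Finset.univ).sup' hE w) *
            density G w T' ≤ density G w S := by
  obtain ⟨T, hT⟩ := hfeas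
  have hne : (Finset.univ.filter (fun W : Finset V => W.Nonempty)).Nonempty := by
    have : T.Nonempty := by
      rw [← Finset.card_pos]; have := hT.1; omega
    exact ⟨T, by simp [this]⟩
  obtain ⟨W, hW, hmax⟩ := Finset.exists_max_image _
    (fun W : Finset V => ((edgesIn G W).card : ℝ) / W.card) hne
  have hWne : W.Nonempty := by simpa using hW
  obtain ⟨S, hS, hdense⟩ := exists_dense G k hk T W hT hWne
  refine ⟨S, hS, fun T' hT' => ?_⟩
  set m := (edgesIn G Finset.univ).inf' hE w with hm
  set M := (edgesIn G Finset.univ).sup' hE w with hM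
  have hsub : ∀ X : Finset V, ∀ e ∈ edgesIn G X, e ∈ edgesIn G Finset.univ := by
    intro X e he
    simp only [edgesIn, Finset.mem_filter, Finset.mem_univ, true_and] at he ⊢
    exact ⟨he.1, fun _ _ => trivial⟩
  have hmpos : 0 < m := by
    rw [hm, Finset.lt_inf'_iff]
    intro e he
    apply hw
    simp only [edgesIn, Finset.mem_filter, Finset.mem_univ, true_and] at he
    exact he.1
  have hmM : m ≤ M := by
    obtain ⟨e, he⟩ := hE
    exact (Finset.inf'_le w he).trans (Finset.le_sup' w he)
  have hMpos : 0 < M := lt_of_lt_of_le hmpos hmM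
  have hSpos : (0 : ℝ) < S.card := by
    have := hS.1
    exact_mod_cast (by omega : 0 < S.card)
  have hTpos : (0 : ℝ) < T'.card := by exact_mod_cast hT'.card_pos
  have h1 : wsum G w T' ≤ M * (edgesIn G T').card := by
    unfold wsum
    calc _ ≤ ∑ e ∈ edgesIn G T', M :=
          Finset.sum_le_sum fun e he => Finset.le_sup' w (hsub T' e he)
      _ = _ := by simp [mul_comm]
  have h2 : m * (edgesIn G S).card ≤ wsum G w S := by
    unfold wsum
    calc _ = ∑ e ∈ edgesIn G S, m := by simp [mul_comm]
      _ ≤ _ := Finset.sum_le_sum fun e he => Finset.inf'_le w (hsub S e he)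
  have h3 : ((edgesIn G T').card : ℝ) / T'.card ≤ ((edgesIn G W).card : ℝ) / W.card :=
    hmax T' (by simp [hT'])
  have h4 : density G w T' ≤ M * (((edgesIn G W).card : ℝ) / W.card) := by
    unfold density
    calc wsum G w T' / T'.card ≤ M * (edgesIn G T').card / T'.card := by gcongr
      _ = M * (((edgesIn G T').card : ℝ) / T'.card) := by ring
      _ ≤ _ := by gcongr
  have h5 : m * (6 / 19 * (((edgesIn G W).card : ℝ) / W.card)) ≤ density G w S := by
    unfold density
    rw [le_div_iff₀ hSpos]
    calc _ = m * (6 / 19 * (((edgesIn G W).card : ℝ) / W.card) * S.card) := by ring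
      _ ≤ m * (edgesIn G S).card := by gcongr
      _ ≤ _ := h2
  calc (6 : ℝ) / 19 * (m / M) * density G w T'
      ≤ 6 / 19 * (m / M) * (M * (((edgesIn G W).card : ℝ) / W.card)) := by gcongr
    _ = m * (6 / 19 * (((edgesIn G W).card : ℝ) / W.card)) := by field_simp
    _ ≤ _ := h5
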